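/- arXiv:2010.08230 — 14 statements merged into one kernel-verified Lean document; each statement's English description precedes it below -/
import Mathlib

section
/- Let C be a category. Let (L, K, R, L', K', l, r, t_L, t_K, l') be a PBPO⁺ rule (so t_L and t_K are monomorphisms and the square t_L ∘ l = l' ∘ t_K is a pullback). Let m : L → G_L and α : G_L → L' form a strong match for t_L, and let g_L : G_K → G_L, u' : G_K → K' form a pullback of the cospan α : G_L → L', l' : K' → L'. Then there exists a morphism u : K → G_K such that (l : K → L, u : K → G_K) is a pullback of the cospan m : L → G_L, g_L : G_K → G_L, such that u' ∘ u = t_K, and such that u is a monomorphism. -/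
open CategoryTheory CategoryTheory.Limits

universe v u

/-- **Top-Left Pullback Lemma for PBPO⁺.**
Given a PBPO⁺ rule (tL, tK monic, the square `l ≫ tL = tK ≫ l'` a pullback),
a strong match `(m, α)` for `tL` (a pullback square `𝟙 L ≫ tL = m ≫ α`),
and a pullback `(gL, u')` of the cospan `(α, l')`, there exists `u : K ⟶ G_K`
such that `(l, u)` is a pullback of the cospan `(m, gL)`, `u ≫ u' = tK`,
and `u` is a monomorphism. -/
theorem pbpoPlus_topLeft_pullback
    {C : Type u} [Category.{v} C]
    {L K R L' K' G_L G_K : C}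
    (l : K ⟶ L) (r : K ⟶ R) (tL : L ⟶ L') (tK : K ⟶ K') (l' : K' ⟶ L')
    [Mono tL] [Mono tK]
    (hrule : IsPullback l tK tL l')
    (m : L ⟶ G_L) (α : G_L ⟶ L')
    (hmatch : IsPullback (𝟙 L) m tL α)
    (gL : G_K ⟶ G_L) (u' : G_K ⟶ K')
    (hpb : IsPullback gL u' α l') :
    ∃ u : K ⟶ G_K, IsPullback l u m gL ∧ u ≫ u' = tK ∧ Mono u := by
  have hw : m ≫ α = tL := by simpa using hmatch.w.symm
  have hsq : IsPullback l tK (m ≫ α) l' := hw ▸ hrule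
  have hu : hpb.lift (l ≫ m) tK (by rw [Category.assoc, hsq.w]) ≫ u' = tK := hpb.lift_snd _ _ _
  exact ⟨_, hsq.of_bot' hpb, hu, mono_of_mono_fac hu⟩
end

section
/- Let C be any category. Let (L, K, R, L', K', l, r, t_L, t_K, l') be a PBPO⁺ rule, let m : L → G_L and α : G_L → L' form a strong match for t_L, and let g_L : G_K → G_L, u' : G_K → K' form a pullback of the cospan α : G_L → L', l' : K' → L'. Then there is exactly one morphism v : K → G_K satisfying u' ∘ v = t_K. -/
open CategoryTheory CategoryTheory.Limits

universe v u

/-- **Uniqueness of `u`.**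
Given a PBPO⁺ rule, a strong match `(m, α)` for `tL`, and a pullback
`(gL, u')` of the cospan `(α, l')`, there is exactly one morphism
`v : K ⟶ G_K` satisfying `v ≫ u' = tK`. -/
theorem pbpoPlus_unique_u
    {C : Type u} [Category.{v} C]
    {L K R L' K' G_L G_K : C}
    (l : K ⟶ L) (r : K ⟶ R) (tL : L ⟶ L') (tK : K ⟶ K') (l' : K' ⟶ L')
    [Mono tL] [Mono tK]
    (hrule : IsPullback l tK tL l')
    (m : L ⟶ G_L) (α : G_L ⟶ L')
    (hmatch : IsPullback (𝟙 L) m tL α)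
    (gL : G_K ⟶ G_L) (u' : G_K ⟶ K')
    (hpb : IsPullback gL u' α l') :
    ∃! v : K ⟶ G_K, v ≫ u' = tK := by
  have hm : m ≫ α = tL := by simpa using hmatch.w.symm
  refine ⟨hpb.lift (l ≫ m) tK (by rw [Category.assoc, hm, hrule.w]), hpb.lift_snd _ _ _, ?_⟩
  intro v hv
  -- The strong match forces the component of `v` in `G_L` to factor through `m`.
  have hα : l ≫ tL = (v ≫ gL) ≫ α := by
    rw [Category.assoc, hpb.w, ← Category.assoc, hv, hrule.w]
  have hl : hmatch.lift l (v ≫ gL) hα = l := by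
    simpa using hmatch.lift_fst l (v ≫ gL) hα
  have hgL : l ≫ m = v ≫ gL := by
    simpa only [hl] using hmatch.lift_snd l (v ≫ gL) hα
  apply hpb.hom_ext
  · rw [hpb.lift_fst, hgL]
  · rw [hpb.lift_snd, hv]
end

section
/- Let C be a category. Let (L, K, R, L', K', l, r, t_L, t_K, l') be a PBPO⁺ rule, and let r' : K' → R', t_R : R → R' form a pushout of the span t_K : K → K', r : K → R. Let m : L → G_L and α : G_L → L' form a strong match for t_L, let g_L : G_K → G_L, u' : G_K → K' form a pullback of the cospan α : G_L → L', l' : K' → L', let u : K → G_K be a morphism satisfying u' ∘ u = t_K, and let g_R : G_K → G_R, w : R → G_R form a pushout of the span u : K → G_K, r : K → R. Then there exists a morphism w' : G_R → R' such that w' ∘ w = t_R and such that (r' : K' → R', w' : G_R → R') is a pushout of the span u' : G_K → K', g_R : G_K → G_R. -/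
open CategoryTheory CategoryTheory.Limits

universe v u

/-- **Bottom-Right Pushout Lemma for PBPO⁺.**
Given a PBPO⁺ rule, a pushout `(r', tR)` of the span `(tK, r)`,
a strong match `(m, α)` for `tL`, a pullback `(gL, u')` of the cospan `(α, l')`,
a morphism `u : K ⟶ G_K` with `u ≫ u' = tK`, and a pushout `(gR, w)` of
the span `(u, r)`, there exists `w' : G_R ⟶ R'` such that `w ≫ w' = tR`
and `(r', w')` is a pushout of the span `(u', gR)`. -/
theorem pbpoPlus_bottomRight_pushout
    {C : Type u} [Category.{v} C]
    {L K R L' K' R' G_L G_K G_R : C}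
    (l : K ⟶ L) (r : K ⟶ R) (tL : L ⟶ L') (tK : K ⟶ K') (l' : K' ⟶ L')
    [Mono tL] [Mono tK]
    (hrule : IsPullback l tK tL l')
    (r' : K' ⟶ R') (tR : R ⟶ R')
    (hpo : IsPushout tK r r' tR)
    (m : L ⟶ G_L) (α : G_L ⟶ L')
    (hmatch : IsPullback (𝟙 L) m tL α)
    (gL : G_K ⟶ G_L) (u' : G_K ⟶ K')
    (hpb : IsPullback gL u' α l')
    (u : K ⟶ G_K) (hu : u ≫ u' = tK)
    (gR : G_K ⟶ G_R) (w : R ⟶ G_R)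
    (hpo2 : IsPushout u r gR w) :
    ∃ w' : G_R ⟶ R', w ≫ w' = tR ∧ IsPushout u' gR r' w' := by
  have hcomm : u ≫ u' ≫ r' = r ≫ tR := by rw [← Category.assoc, hu, hpo.w]
  refine ⟨hpo2.desc (u' ≫ r') tR hcomm, hpo2.inr_desc _ _ _, ?_⟩
  refine IsPushout.of_left ?_ (hpo2.inl_desc _ _ _).symm hpo2
  rwa [hu, hpo2.inr_desc]
end

section
/- Let C be a category with pullbacks and pushouts. Let ρ = (L, K, R, L', K', R', l, r, t_L, t_K, t_R, l', r') be a canonical PBPO rule, and let t_L = t_{L_c} ∘ e be a factorization of t_L through an object L_c where e : L → L_c is an epimorphism. Then there exist objects K_c, R_c and morphisms l_c : K_c → L_c, r_c : K_c → R_c, e_K : K → K_c, e_R : R → R_c, t_{K_c} : K_c → K', t_{R_c} : R_c → R' such that: (i) the square t_{L_c} ∘ l_c = l' ∘ t_{K_c} is a pullback; (ii) the square t_{R_c} ∘ r_c = r' ∘ t_{K_c} is a pushout; (iii) the square e ∘ l = l_c ∘ e_K is a pullback; (iv) the square e_R ∘ r = r_c ∘ e_K is a pushout; (v) t_K = t_{K_c}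 ∘ e_K and t_R = t_{R_c} ∘ e_R. (The lower data (L_c, K_c, R_c, L', K', R', l_c, r_c, t_{L_c}, t_{K_c}, t_{R_c}, l', r') is called the compacted rule ρ_e.) -/
open CategoryTheory CategoryTheory.Limits

universe v u

/-- **Existence of the compacted rule.**
Let `ρ` be a canonical PBPO rule (left square `l ≫ tL = tK ≫ l'` a pullback,
right square `tK ≫ r' = r ≫ tR` a pushout), and let `tL = e ≫ tLc` be a
factorization with `e` epic. Then there exist `K_c`, `R_c` and morphisms
forming the compacted rule `ρ_e`:
(i) `(l_c, tKc)` is a pullback of `(tLc, l')`;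
(ii) `(r', tRc)` is a pushout of `(tKc, r_c)`;
(iii) `(l, e_K)` is a pullback of `(e, l_c)`;
(iv) `(r_c, e_R)` is a pushout of `(e_K, r)`;
(v) `tK = e_K ≫ tKc` and `tR = e_R ≫ tRc`. -/
theorem compacted_rule_exists
    {C : Type u} [Category.{v} C] [HasPullbacks C] [HasPushouts C]
    {L K R L' K' R' Lc : C}
    (l : K ⟶ L) (r : K ⟶ R) (tL : L ⟶ L') (tK : K ⟶ K') (tR : R ⟶ R')
    (l' : K' ⟶ L') (r' : K' ⟶ R')
    (hPB : IsPullback l tK tL l') (hPO : IsPushout tK r r' tR)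
    (e : L ⟶ Lc) [Epi e] (tLc : Lc ⟶ L') (hfac : tL = e ≫ tLc) :
    ∃ (Kc Rc : C) (lc : Kc ⟶ Lc) (rc : Kc ⟶ Rc) (eK : K ⟶ Kc) (eR : R ⟶ Rc)
      (tKc : Kc ⟶ K') (tRc : Rc ⟶ R'),
      IsPullback lc tKc tLc l' ∧
      IsPushout tKc rc r' tRc ∧
      IsPullback l eK e lc ∧
      IsPushout eK r rc eR ∧
      tK = eK ≫ tKc ∧ tR = eR ≫ tRc := by
  subst hfac
  have hc := IsPullback.of_hasPullback tLc l'
  have hK : (l ≫ e) ≫ tLc = tK ≫ l' := by rw [Category.assoc, hPB.w]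
  have hKsnd := hc.lift_snd (l ≫ e) tK hK
  have hKc := IsPullback.of_bot' hPB hc
  have hRc := IsPushout.of_hasPushout (hc.lift (l ≫ e) tK hK) r
  rw [← hKsnd] at hPO
  have hRc' := IsPushout.of_left' hPO hRc
  exact ⟨_, _, _, _, _, _, _, _, hc, hRc', hKc, hRc, hKsnd.symm, (hRc.inr_desc _ _ _).symm⟩
end

section
/- Let C be a category with pullbacks and pushouts. Let ρ = (L, K, R, L', K', R', l, r, t_L, t_K, t_R, l', r') be a canonical PBPO rule, let e : L → L_c be an epimorphism and t_{L_c} : L_c → L' a morphism with t_L = t_{L_c} ∘ e, and let ρ_e = (L_c, K_c, R_c, L', K', R', l_c, r_c, t_{L_c}, t_{K_c}, t_{R_c}, l', r') be the compacted rule obtained from ρ and this factorization. Then for every monomorphism m' : L_c → G_L and every α : G_L → L': there is a PBPO step G_L ⇒_ρ^{(m' ∘ e), α} G_R if and only if there is a PBPO step G_L ⇒_{ρ_e}^{m', α} G_R. -/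
open CategoryTheory CategoryTheory.Limits

universe v u

/-- A PBPO rewrite step `G_L ⇒_ρ^{m,α} G_R` for a canonical PBPO rule with
top span `L ⟵l— K —r⟶ R` and typings `tL, tK` into the bottom span
`L' ⟵l'— K' —r'⟶ R'` (only the data relevant for the step is taken as input). -/
def PBPOStep {C : Type u} [Category.{v} C]
    {L K R L' K' : C}
    (l : K ⟶ L) (r : K ⟶ R) (tL : L ⟶ L') (tK : K ⟶ K') (l' : K' ⟶ L')
    {G_L : C} (G_R : C) (m : L ⟶ G_L) (α : G_L ⟶ L') : Prop :=
  tL = m ≫ α ∧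
  ∃ (G_K : C) (gL : G_K ⟶ G_L) (u' : G_K ⟶ K') (u : K ⟶ G_K)
    (gR : G_K ⟶ G_R) (w : R ⟶ G_R),
    IsPullback gL u' α l' ∧ u ≫ gL = l ≫ m ∧ u ≫ u' = tK ∧
    IsPushout u r gR w

/-- **Compacted-rule step correspondence.**
Let `ρ` be a canonical PBPO rule, `tL = e ≫ tLc` a factorization with `e` epic,
and let `ρ_e` be the compacted rule obtained from this factorization. Then for
every monomorphism `m' : L_c ⟶ G_L` and every `α : G_L ⟶ L'`, we have
`G_L ⇒_ρ^{(e ≫ m'), α} G_R` iff `G_L ⇒_{ρ_e}^{m', α} G_R`. -/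
theorem compacted_rule_step_iff
    {C : Type u} [Category.{v} C] [HasPullbacks C] [HasPushouts C]
    {L K R L' K' R' Lc Kc Rc : C}
    (l : K ⟶ L) (r : K ⟶ R) (tL : L ⟶ L') (tK : K ⟶ K') (tR : R ⟶ R')
    (l' : K' ⟶ L') (r' : K' ⟶ R')
    (hPB : IsPullback l tK tL l') (hPO : IsPushout tK r r' tR)
    -- the factorization of `tL` through an epi `e`
    (e : L ⟶ Lc) [Epi e] (tLc : Lc ⟶ L') (hfac : tL = e ≫ tLc)
    -- the compacted rule `ρ_e`
    (lc : Kc ⟶ Lc) (tKc : Kc ⟶ K') (hKc : IsPullback lc tKc tLc l')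
    (eK : K ⟶ Kc) (heK₁ : eK ≫ lc = l ≫ e) (heK₂ : eK ≫ tKc = tK)
    (rc : Kc ⟶ Rc) (eR : R ⟶ Rc) (hRc : IsPushout eK r rc eR)
    (tRc : Rc ⟶ R') (htRc₁ : tKc ≫ r' = rc ≫ tRc) (htRc₂ : eR ≫ tRc = tR)
    -- a monic match for the compacted rule
    {G_L : C} (G_R : C) (m' : Lc ⟶ G_L) [Mono m'] (α : G_L ⟶ L') :
    PBPOStep l r tL tK l' G_R (e ≫ m') α ↔
    PBPOStep lc rc tLc tKc l' G_R m' α := by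
  subst hfac
  constructor
  · rintro ⟨hα, G_K, gL, u', u, gR, w, hG, hu₁, hu₂, hP⟩
    have hαc : tLc = m' ≫ α := by
      rw [← cancel_epi e, hα, Category.assoc]
    have hcomm : (lc ≫ m') ≫ α = tKc ≫ l' := by
      rw [Category.assoc, ← hαc, hKc.w]
    have hu : eK ≫ hG.lift (lc ≫ m') tKc hcomm = u := by
      apply hG.hom_ext
      · rw [Category.assoc, hG.lift_fst, ← Category.assoc, heK₁, hu₁, Category.assoc]
      · rw [Category.assoc, hG.lift_snd, heK₂, hu₂]
    subst hu
    have hdesc : eK ≫ hG.lift (lc ≫ m') tKc hcomm ≫ gR = r ≫ w := by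
      rw [← Category.assoc, hP.w]
    refine ⟨hαc, G_K, gL, u', hG.lift (lc ≫ m') tKc hcomm, gR, hRc.desc _ w hdesc, hG,
      hG.lift_fst .., hG.lift_snd .., ?_⟩
    refine IsPushout.of_left (h₁₁ := eK) (h₂₁ := eR) ?_ (hRc.inl_desc _ w hdesc).symm hRc
    rwa [hRc.inr_desc]
  · rintro ⟨hα, G_K, gL, u', u, gR, w, hG, hu₁, hu₂, hP⟩
    refine ⟨by rw [hα, Category.assoc], G_K, gL, u', eK ≫ u, gR, eR ≫ w, hG, ?_, ?_,
      hRc.paste_horiz hP⟩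
    · rw [Category.assoc, hu₁, ← Category.assoc, heK₁, Category.assoc]
    · rw [Category.assoc, hu₂, heK₂]
end

section
/- Let C be a category with pullbacks and pushouts in which every morphism factors as an epimorphism followed by a monomorphism. Let ρ be a canonical PBPO rule with typing t_L : L → L'. Then for all objects G_L, G_R: there exist m : L → G_L and α : G_L → L' with a PBPO step G_L ⇒_ρ^{m,α} G_R if and only if there exist an epimorphism e : L → L_c, a morphism t_{L_c} : L_c → L' with t_L = t_{L_c} ∘ e, a monomorphism m' : L_c → G_L, and α : G_L → L' such that there is a PBPO step G_L ⇒_{ρ_e}^{m',α} G_R for the compacted rule ρ_e. -/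
open CategoryTheory CategoryTheory.Limits

universe v u

/-- **Monic matching suffices, via compacted rules.**
In a category with pullbacks and pushouts in which every morphism factors
as an epi followed by a mono, a canonical PBPO rule `ρ` admits a PBPO step
`G_L ⇒_ρ^{m,α} G_R` (for some match `m`, `α`) iff some compacted rule `ρ_e`
of `ρ` admits a PBPO step `G_L ⇒_{ρ_e}^{m',α} G_R` with a *monic* match `m'`. -/
theorem pbpo_step_iff_compacted_monic_step
    {C : Type u} [Category.{v} C] [HasPullbacks C] [HasPushouts C]
    (hfact : ∀ {X Y : C} (f : X ⟶ Y),
      ∃ (Z : C) (e : X ⟶ Z) (m : Z ⟶ Y), Epi e ∧ Mono m ∧ e ≫ m = f)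
    {L K R L' K' R' : C}
    (l : K ⟶ L) (r : K ⟶ R) (tL : L ⟶ L') (tK : K ⟶ K') (tR : R ⟶ R')
    (l' : K' ⟶ L') (r' : K' ⟶ R')
    (hPB : IsPullback l tK tL l') (hPO : IsPushout tK r r' tR)
    (G_L G_R : C) :
    (∃ (m : L ⟶ G_L) (α : G_L ⟶ L'), PBPOStep l r tL tK l' G_R m α) ↔
    (∃ (Lc : C) (e : L ⟶ Lc) (tLc : Lc ⟶ L'),
      Epi e ∧ tL = e ≫ tLc ∧
      ∃ (Kc Rc : C) (lc : Kc ⟶ Lc) (tKc : Kc ⟶ K') (eK : K ⟶ Kc)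
        (rc : Kc ⟶ Rc) (eR : R ⟶ Rc) (tRc : Rc ⟶ R'),
        -- the compacted rule `ρ_e`
        IsPullback lc tKc tLc l' ∧
        eK ≫ lc = l ≫ e ∧ eK ≫ tKc = tK ∧
        IsPushout eK r rc eR ∧
        tKc ≫ r' = rc ≫ tRc ∧ eR ≫ tRc = tR ∧
        -- a step of `ρ_e` with a monic match
        ∃ (m' : Lc ⟶ G_L) (α : G_L ⟶ L'),
          Mono m' ∧ PBPOStep lc rc tLc tKc l' G_R m' α) := by
  constructor
  · rintro ⟨m, α, ht, G_K, gL, u', u, gR, w, hpb, hu, hu', hpo⟩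
    obtain ⟨Lc, e, m', he, hm', rfl⟩ := hfact m
    have hK : (l ≫ e) ≫ m' ≫ α = tK ≫ l' := by
      rw [← hPB.w, ht]
      simp only [Category.assoc]
    let eK : K ⟶ pullback (m' ≫ α) l' := pullback.lift (l ≫ e) tK hK
    have hR : r ≫ tR = eK ≫ pullback.snd (m' ≫ α) l' ≫ r' := by
      rw [← hPO.w, pullback.lift_snd_assoc]
    let uc : pullback (m' ≫ α) l' ⟶ G_K :=
      hpb.lift (pullback.fst (m' ≫ α) l' ≫ m') (pullback.snd (m' ≫ α) l')
        (by rw [Category.assoc, pullback.condition])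
    have huc : eK ≫ uc = u := by
      apply hpb.hom_ext
      · rw [Category.assoc, hpb.lift_fst, pullback.lift_fst_assoc, Category.assoc, hu]
      · rw [Category.assoc, hpb.lift_snd, pullback.lift_snd, hu']
    have hw : eK ≫ uc ≫ gR = r ≫ w := by
      rw [← Category.assoc, huc, hpo.w]
    refine ⟨Lc, e, m' ≫ α, he, by rw [ht, Category.assoc], _, pushout eK r,
      pullback.fst _ _, pullback.snd _ _, eK, pushout.inl _ _, pushout.inr _ _,
      pushout.desc (pullback.snd _ _ ≫ r') tR hR.symm,
      IsPullback.of_hasPullback _ _, pullback.lift_fst _ _ _, pullback.lift_snd _ _ _,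
      IsPushout.of_hasPushout _ _, (pushout.inl_desc _ _ _).symm, pushout.inr_desc _ _ _,
      m', α, hm', rfl, G_K, gL, u', uc, gR, pushout.desc (uc ≫ gR) w hw, hpb,
      hpb.lift_fst _ _ _, hpb.lift_snd _ _ _, ?_⟩
    refine IsPushout.of_left ?_ (pushout.inl_desc _ _ _).symm (IsPushout.of_hasPushout eK r)
    rwa [huc, pushout.inr_desc]
  · rintro ⟨Lc, e, tLc, -, rfl, Kc, Rc, lc, tKc, eK, rc, eR, tRc, -, hl, rfl, hpoc, -, -,
      m', α, -, rfl, G_K, gL, u', u, gR, w, hpb, hu, hu', hpo⟩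
    refine ⟨e ≫ m', α, (Category.assoc _ _ _).symm, G_K, gL, u', eK ≫ u, gR, eR ≫ w, hpb,
      ?_, by rw [Category.assoc, hu'], hpoc.paste_horiz hpo⟩
    rw [Category.assoc, hu, ← Category.assoc, hl, Category.assoc]
end

section
/- Let C be a category such that for every object X the slice category C/X has partial map classifiers. Then C is strongly amendable: for every morphism t_L : L → L' there exists a factorization t_L = β ∘ t_L' with t_L' : L → L'' a monomorphism and β : L'' → L', such that for every factorization t_L = α ∘ m with m : L → G_L a monomorphism and α : G_L → L', there exists a morphism α' : G_L → L'' with β ∘ α' = α, α' ∘ m = t_L', and such that the square with sides 1_L : L → L, m : L → G_L, t_L' : L → L'', α' : G_L → L'' is a pullback square. -/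
open CategoryTheory CategoryTheory.Limits

universe v u

/-- A category `D` has partial map classifiers if every object `A` admits a
monomorphism `η : A ⟶ T` such that for every span `B ⟵i— D₀ —f⟶ A` with `i`
monic there is a unique `φ : B ⟶ T` making the square `f ≫ η = i ≫ φ`
a pullback square. -/
def HasPartialMapClassifiers (D : Type u) [Category.{v} D] : Prop :=
  ∀ A : D, ∃ (T : D) (η : A ⟶ T), Mono η ∧
    ∀ (B D₀ : D) (f : D₀ ⟶ A) (i : D₀ ⟶ B), Mono i →
      ∃! φ : B ⟶ T, IsPullback f i η φ

/-- A category `C` is strongly amendable if every `t_L : L ⟶ L'` factors as a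
mono `t_L' : L ⟶ L''` followed by `β : L'' ⟶ L'` such that every factorization
`t_L = m ≫ α` with `m` monic admits `α'` with `α' ≫ β = α`, `m ≫ α' = t_L'`,
and the square `𝟙 L ≫ t_L' = m ≫ α'` a pullback. -/
def StronglyAmendable (C : Type u) [Category.{v} C] : Prop :=
  ∀ {L L' : C} (tL : L ⟶ L'), ∃ (L'' : C) (tL' : L ⟶ L'') (β : L'' ⟶ L'),
    Mono tL' ∧ tL' ≫ β = tL ∧
    ∀ (G_L : C) (m : L ⟶ G_L) (α : G_L ⟶ L'), Mono m → m ≫ α = tL →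
      ∃ α' : G_L ⟶ L'', α' ≫ β = α ∧ m ≫ α' = tL' ∧
        IsPullback (𝟙 L) m tL' α'

/-- A pullback square in a slice category is a pullback square in the base. -/
theorem isPullback_left_of_over {C : Type u} [Category.{v} C] {X : C} {P A B T : Over X}
    {f : P ⟶ A} {i : P ⟶ B} {η : A ⟶ T} {φ : B ⟶ T} (hp : IsPullback f i η φ) :
    IsPullback f.left i.left η.left φ.left :=
  hp.map (Over.forget X)

/-- **Partial map classifiers in all slices imply strong amendability.** -/
theorem stronglyAmendable_of_slice_partialMapClassifiers
    {C : Type u} [Category.{v} C]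
    (h : ∀ X : C, HasPartialMapClassifiers (Over X)) :
    StronglyAmendable C := by
  intro L L' tL
  obtain ⟨T, η, hη, hT⟩ := h L' (Over.mk tL)
  refine ⟨T.left, η.left, T.hom, inferInstance, Over.w η, ?_⟩
  intro G m α hm hmα
  let i : Over.mk tL ⟶ Over.mk α := Over.homMk m hmα
  have hi : Mono i := Over.mono_of_mono_left (hk := hm) i
  obtain ⟨φ, hφ, -⟩ := hT (Over.mk α) (Over.mk tL) (𝟙 _) i hi
  have hp : IsPullback (𝟙 L) m η.left φ.left := isPullback_left_of_over hφ
  exact ⟨φ.left, Over.w φ, by simpa using hp.w.symm, hp⟩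
end

section
/- Let C be an amendable category with pullbacks and pushouts. For every canonical PBPO rule ρ there exists a monic canonical PBPO rule σ (i.e. a canonical PBPO rule whose typing t_L' : L → L'' is a monomorphism) with the same left-hand side pattern L, such that for all objects G_L, G_R: there is a PBPO step G_L ⇒_ρ^{m,α} G_R for some monomorphism m and some α if and only if there is a PBPO step G_L ⇒_σ^{m,α''} G_R for some m and α''. -/
open CategoryTheory CategoryTheory.Limits

universe v u

/-- A category `C` is amendable if every `t_L : L ⟶ L'` factors as a mono
`t_L' : L ⟶ L''` followed by `β : L'' ⟶ L'` such that every factorization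
`t_L = m ≫ α` with `m` monic admits `α'` with `α' ≫ β = α` and `m ≫ α' = t_L'`. -/
def Amendable (C : Type u) [Category.{v} C] : Prop :=
  ∀ {L L' : C} (tL : L ⟶ L'), ∃ (L'' : C) (tL' : L ⟶ L'') (β : L'' ⟶ L'),
    Mono tL' ∧ tL' ≫ β = tL ∧
    ∀ (G_L : C) (m : L ⟶ G_L) (α : G_L ⟶ L'), Mono m → m ≫ α = tL →
      ∃ α' : G_L ⟶ L'', α' ≫ β = α ∧ m ≫ α' = tL'

/-- **Monic matching can be traded for a monic rule.**
In an amendable category with pullbacks and pushouts, for every canonical PBPO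
rule `ρ` there is a *monic* canonical PBPO rule `σ` with the same left-hand side
pattern `L` such that, for all `G_L`, `G_R`, `ρ` admits a PBPO step with a
monic match iff `σ` admits a PBPO step. -/
theorem amendable_monic_rule
    {C : Type u} [Category.{v} C] [HasPullbacks C] [HasPushouts C]
    (hA : Amendable C)
    {L K R L' K' R' : C}
    (l : K ⟶ L) (r : K ⟶ R) (tL : L ⟶ L') (tK : K ⟶ K') (tR : R ⟶ R')
    (l' : K' ⟶ L') (r' : K' ⟶ R')
    (hPB : IsPullback l tK tL l') (hPO : IsPushout tK r r' tR) :
    ∃ (K₂ R₂ L'' K'' R'' : C) (l₂ : K₂ ⟶ L) (r₂ : K₂ ⟶ R₂)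
      (tL₂ : L ⟶ L'') (tK₂ : K₂ ⟶ K'') (tR₂ : R₂ ⟶ R'')
      (l'' : K'' ⟶ L'') (r'' : K'' ⟶ R''),
      Mono tL₂ ∧
      IsPullback l₂ tK₂ tL₂ l'' ∧ IsPushout tK₂ r₂ r'' tR₂ ∧
      ∀ (G_L G_R : C),
        (∃ (m : L ⟶ G_L) (α : G_L ⟶ L'),
            Mono m ∧ PBPOStep l r tL tK l' G_R m α) ↔
        (∃ (m : L ⟶ G_L) (α'' : G_L ⟶ L''),
            PBPOStep l₂ r₂ tL₂ tK₂ l'' G_R m α'') := by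
  obtain ⟨L'', tL₂, β, hmono, hβ, hfact⟩ := hA tL
  have hβl : IsPullback (pullback.fst β l') (pullback.snd β l') β l' :=
    IsPullback.of_hasPullback β l'
  have hw : (l ≫ tL₂) ≫ β = tK ≫ l' := by rw [Category.assoc, hβ, hPB.w]
  have htK : hβl.lift (l ≫ tL₂) tK hw ≫ pullback.snd β l' = tK := hβl.lift_snd _ _ _
  have hPB₂ : IsPullback l (hβl.lift (l ≫ tL₂) tK hw) tL₂ (pullback.fst β l') := by
    refine IsPullback.of_bot ?_ (hβl.lift_fst _ _ _).symm hβl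
    rwa [htK, hβ]
  refine ⟨K, R, L'', pullback β l', pushout (hβl.lift (l ≫ tL₂) tK hw) r, l, r, tL₂,
    hβl.lift (l ≫ tL₂) tK hw, pushout.inr _ _, pullback.fst β l', pushout.inl _ _,
    hmono, hPB₂, IsPushout.of_hasPushout _ _, fun G_L G_R => ⟨?_, ?_⟩⟩
  · rintro ⟨m, α, hm, hα, G_K, gL, u', u, gR, w, hpb, hu, hu', hpo⟩
    obtain ⟨α', hα'β, hmα'⟩ := hfact G_L m α hm hα.symm
    have hw' : (gL ≫ α') ≫ β = u' ≫ l' := by rw [Category.assoc, hα'β, hpb.w]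
    refine ⟨m, α', hmα'.symm, G_K, gL, hβl.lift (gL ≫ α') u' hw', u, gR, w, ?_, hu, ?_, hpo⟩
    · refine IsPullback.of_bot ?_ (hβl.lift_fst _ _ _).symm hβl
      rwa [hβl.lift_snd, hα'β]
    · apply hβl.hom_ext
      · rw [Category.assoc, hβl.lift_fst, hβl.lift_fst, ← Category.assoc, hu, Category.assoc,
          hmα']
      · rw [Category.assoc, hβl.lift_snd, hβl.lift_snd, hu']
  · rintro ⟨m, α', hα', G_K, gL, u'', u, gR, w, hpb, hu, hu'', hpo⟩
    have hm : Mono (m ≫ α') := hα' ▸ hmono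
    refine ⟨m, α' ≫ β, mono_of_mono m α', ?_, G_K, gL, u'' ≫ pullback.snd β l', u, gR, w,
      hpb.paste_vert hβl, hu, ?_, hpo⟩
    · rw [← Category.assoc, ← hα', hβ]
    · rw [← Category.assoc, hu'', htK]
end

section
/- Let C be a strongly amendable category with pullbacks and pushouts. For every canonical PBPO rule ρ there exists a monic canonical PBPO rule σ (i.e. one whose typing t_L' : L → L'' is a monomorphism) with the same left-hand side pattern L, such that for all objects G_L, G_R: there is a PBPO step G_L ⇒_ρ^{m,α} G_R for some monomorphism m and some α if and only if there is a PBPO step G_L ⇒_σ^{m,α''} G_R for some m and α'' forming a strong match for the typing of σ (i.e. the square with sides 1_L, m, t_L', α'' is a pullback). -/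
open CategoryTheory CategoryTheory.Limits

universe v u

/-- **Monic matching can be traded for a monic rule with strong matching.**
In a strongly amendable category with pullbacks and pushouts, for every
canonical PBPO rule `ρ` there is a *monic* canonical PBPO rule `σ` with the
same left-hand side pattern `L` such that, for all `G_L`, `G_R`, `ρ` admits a
PBPO step with a monic match iff `σ` admits a PBPO step whose match is a
strong match for the typing of `σ`. -/
theorem stronglyAmendable_monic_rule_strong_match
    {C : Type u} [Category.{v} C] [HasPullbacks C] [HasPushouts C]
    (hA : StronglyAmendable C)
    {L K R L' K' R' : C}
    (l : K ⟶ L) (r : K ⟶ R) (tL : L ⟶ L') (tK : K ⟶ K') (tR : R ⟶ R')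
    (l' : K' ⟶ L') (r' : K' ⟶ R')
    (hPB : IsPullback l tK tL l') (hPO : IsPushout tK r r' tR) :
    ∃ (K₂ R₂ L'' K'' R'' : C) (l₂ : K₂ ⟶ L) (r₂ : K₂ ⟶ R₂)
      (tL₂ : L ⟶ L'') (tK₂ : K₂ ⟶ K'') (tR₂ : R₂ ⟶ R'')
      (l'' : K'' ⟶ L'') (r'' : K'' ⟶ R''),
      Mono tL₂ ∧
      IsPullback l₂ tK₂ tL₂ l'' ∧ IsPushout tK₂ r₂ r'' tR₂ ∧
      ∀ (G_L G_R : C),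
        (∃ (m : L ⟶ G_L) (α : G_L ⟶ L'),
            Mono m ∧ PBPOStep l r tL tK l' G_R m α) ↔
        (∃ (m : L ⟶ G_L) (α'' : G_L ⟶ L''),
            IsPullback (𝟙 L) m tL₂ α'' ∧
            PBPOStep l₂ r₂ tL₂ tK₂ l'' G_R m α'') := by
  obtain ⟨L'', tL₂, β, hmono, hfac, hsa⟩ := hA tL
  have hβ : IsPullback (pullback.fst β l') (pullback.snd β l') β l' :=
    IsPullback.of_hasPullback β l'
  have hw : (l ≫ tL₂) ≫ β = tK ≫ l' := by rw [Category.assoc, hfac, hPB.w]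
  have hlift : hβ.lift (l ≫ tL₂) tK hw ≫ pullback.snd β l' = tK := hβ.lift_snd _ _ _
  refine ⟨K, R, L'', pullback β l', pushout (hβ.lift (l ≫ tL₂) tK hw) r, l, r, tL₂,
    hβ.lift (l ≫ tL₂) tK hw, pushout.inr _ _, pullback.fst β l', pushout.inl _ _, hmono,
    IsPullback.of_bot (by rwa [hlift, hfac]) (hβ.lift_fst _ _ _).symm hβ,
    IsPushout.of_hasPushout _ _, fun G_L G_R => ⟨?_, ?_⟩⟩
  · rintro ⟨m, α, hm, hmα, G_K, gL, u', u, gR, w, hpb, hu, hu', hpo⟩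
    obtain ⟨α', hα', hmα', hstrong⟩ := hsa G_L m α hm hmα.symm
    have hw' : (gL ≫ α') ≫ β = u' ≫ l' := by rw [Category.assoc, hα', hpb.w]
    refine ⟨m, α', hstrong, hmα'.symm, G_K, gL, hβ.lift (gL ≫ α') u' hw', u, gR, w,
      IsPullback.of_bot (by rwa [hβ.lift_snd, hα']) (hβ.lift_fst _ _ _).symm hβ, hu, ?_, hpo⟩
    apply hβ.hom_ext
    · rw [Category.assoc, hβ.lift_fst, hβ.lift_fst, reassoc_of% hu, hmα']
    · rw [Category.assoc, hβ.lift_snd, hβ.lift_snd, hu']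
  · rintro ⟨m, α'', -, hmα, G_K, gL, u', u, gR, w, hpb, hu, hu', hpo⟩
    refine ⟨m, α'' ≫ β, mono_of_mono_fac hmα.symm, ?_, G_K, gL, u' ≫ pullback.snd β l', u, gR, w,
      hpb.paste_vert hβ, hu, ?_, hpo⟩
    · rw [← Category.assoc, ← hmα, hfac]
    · rw [reassoc_of% hu', hlift]
end

section
/- Let C be a locally small, strongly amendable category with pullbacks and pushouts in which every morphism factors as an epimorphism followed by a monomorphism. Then for every canonical PBPO rule ρ there exists a set S of PBPO⁺ rules such that for all objects G_L, G_R: there is a PBPO step G_L ⇒_ρ^{m,α} G_R for some m, α if and only if there is a rule σ ∈ S and a PBPO⁺ step G_L ⇒_σ G_R. -/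
open CategoryTheory CategoryTheory.Limits

universe v u

/-- A PBPO⁺ rewrite rule: monic typings `tL`, `tK` and a pullback square
`l ≫ tL = tK ≫ l'`. -/
structure PBPOPlusRule (C : Type u) [Category.{v} C] where
  L : C
  K : C
  R : C
  L' : C
  K' : C
  l : K ⟶ L
  r : K ⟶ R
  tL : L ⟶ L'
  tK : K ⟶ K'
  l' : K' ⟶ L'
  mono_tL : Mono tL
  mono_tK : Mono tK
  isPullback : IsPullback l tK tL l'

/-- The PBPO⁺ rewrite step `G_L ⇒_σ G_R`: there is a strong match `(m, α)`
for `tL`, a pullback `(gL, u')` of `(α, l')`, the (unique) morphism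
`u : K ⟶ G_K` with `u ≫ u' = tK`, and a pushout `(gR, w)` of `(u, r)`. -/
def PBPOPlusStep {C : Type u} [Category.{v} C]
    (σ : PBPOPlusRule C) (G_L G_R : C) : Prop :=
  ∃ (m : σ.L ⟶ G_L) (α : G_L ⟶ σ.L'),
    IsPullback (𝟙 σ.L) m σ.tL α ∧
    ∃ (G_K : C) (gL : G_K ⟶ G_L) (u' : G_K ⟶ σ.K') (u : σ.K ⟶ G_K)
      (gR : G_K ⟶ G_R) (w : σ.R ⟶ G_R),
      IsPullback gL u' α σ.l' ∧ u ≫ u' = σ.tK ∧ IsPushout u σ.r gR w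

/-- `σ` refines the PBPO rule `ρ`: its bottom morphism is a pullback of that of `ρ`, its typings
extend those of `ρ`, and its right-hand side is a pushout of that of `ρ`. -/
def PBPOPlusRule.Refines {C : Type u} [Category.{v} C] (σ : PBPOPlusRule C)
    {L K R L' K' : C}
    (l : K ⟶ L) (r : K ⟶ R) (tL : L ⟶ L') (tK : K ⟶ K') (l' : K' ⟶ L') : Prop :=
  ∃ (β : σ.L' ⟶ L') (β' : σ.K' ⟶ K') (e : L ⟶ σ.L) (k : K ⟶ σ.K) (j : R ⟶ σ.R),
    IsPullback σ.l' β' β l' ∧ k ≫ σ.l = l ≫ e ∧ e ≫ σ.tL ≫ β = tL ∧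
    k ≫ σ.tK ≫ β' = tK ∧ IsPushout k r σ.r j

/-- A PBPO⁺ step with a rule refining `ρ` gives a PBPO step with `ρ`. -/
theorem PBPOPlusRule.Refines.exists_pbpoStep {C : Type u} [Category.{v} C] {σ : PBPOPlusRule C}
    {L K R L' K' : C}
    {l : K ⟶ L} {r : K ⟶ R} {tL : L ⟶ L'} {tK : K ⟶ K'} {l' : K' ⟶ L'}
    (h : σ.Refines l r tL tK l') {G_L G_R : C} (hs : PBPOPlusStep σ G_L G_R) :
    ∃ (m : L ⟶ G_L) (α : G_L ⟶ L'), PBPOStep l r tL tK l' G_R m α := by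
  obtain ⟨β, β', e, k, j, hβ, hkl, he, hk, hj⟩ := h
  obtain ⟨m, α, hm, G_K, gL, u', u, gR, w, hG, hu, hpo⟩ := hs
  have hugL : u ≫ gL = σ.l ≫ m := by
    have w' : σ.l ≫ σ.tL = (u ≫ gL) ≫ α := by
      rw [Category.assoc, hG.w, reassoc_of% hu, σ.isPullback.w]
    have h₁ := hm.lift_fst _ _ w'
    rw [Category.comp_id] at h₁
    rw [← hm.lift_snd _ _ w', h₁]
  refine ⟨e ≫ m, α ≫ β, ?_, G_K, gL, u' ≫ β', k ≫ u, gR, j ≫ w, ?_, ?_, ?_, ?_⟩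
  · have h₂ := hm.w
    rw [Category.id_comp] at h₂
    rw [← he, h₂]
    simp only [Category.assoc]
  · exact (hG.flip.paste_horiz hβ.flip).flip
  · rw [Category.assoc, hugL, reassoc_of% hkl]
  · rw [Category.assoc, reassoc_of% hu, hk]
  · exact hj.paste_horiz hpo

/-- A PBPO step whose match factors through a mono into the host graph is a PBPO⁺ step with a rule
refining `ρ`, provided the induced typing of the mono has an amendment. -/
theorem PBPOStep.exists_refines {C : Type u} [Category.{v} C] [HasPullbacks C] [HasPushouts C]
    {L K R L' K' : C}
    {l : K ⟶ L} {r : K ⟶ R} {tL : L ⟶ L'} {tK : K ⟶ K'} {l' : K' ⟶ L'}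
    (hw : l ≫ tL = tK ≫ l') {G_L G_R : C} {m : L ⟶ G_L} {α : G_L ⟶ L'}
    (hs : PBPOStep l r tL tK l' G_R m α)
    {M M' : C} {e : L ⟶ M} {n : M ⟶ G_L} (hen : e ≫ n = m)
    {t : M ⟶ M'} [Mono t] {β : M' ⟶ L'} {α' : G_L ⟶ M'} (hα : α' ≫ β = α)
    (hn : n ≫ α' = t) (hstrong : IsPullback (𝟙 M) n t α') :
    ∃ σ : PBPOPlusRule C, σ.Refines l r tL tK l' ∧ PBPOPlusStep σ G_L G_R := by
  obtain ⟨rfl, G_K, gL, u', u, gR, w, hG, hugL, huu', hpo⟩ := hs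
  subst hen hα
  have hβ := IsPullback.of_hasPullback β l'
  have hK := IsPullback.of_hasPullback t (pullback.fst β l')
  let k : K ⟶ pullback t (pullback.fst β l') :=
    hK.lift (l ≫ e) (hβ.lift (l ≫ e ≫ t) tK (by simpa [← hn] using hw)) (by simp)
  have hkl : k ≫ pullback.fst t (pullback.fst β l') = l ≫ e := hK.lift_fst _ _ _
  have hkt : k ≫ pullback.snd t (pullback.fst β l') ≫ pullback.snd β l' = tK := by
    rw [← Category.assoc, hK.lift_snd, hβ.lift_snd]
  have hGw : (gL ≫ α') ≫ β = u' ≫ l' := by rw [Category.assoc, hG.w]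
  have hG' : IsPullback gL (hβ.lift (gL ≫ α') u' hGw) α' (pullback.fst β l') := by
    refine (IsPullback.of_right (t := hβ.flip) (h₁₁ := hβ.lift (gL ≫ α') u' hGw) ?_ ?_).flip
    · rw [hβ.lift_snd]; exact hG.flip
    · exact hβ.lift_fst _ _ _
  have hvw : (pullback.fst t (pullback.fst β l') ≫ n) ≫ α' =
      pullback.snd t (pullback.fst β l') ≫ pullback.fst β l' := by
    rw [Category.assoc, hn, hK.w]
  have hkv : k ≫ hG'.lift _ _ hvw = u := by
    apply hG.hom_ext
    · rw [Category.assoc, hG'.lift_fst, reassoc_of% hkl, hugL]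
    · have hvu : hG'.lift _ _ hvw ≫ u' =
          pullback.snd t (pullback.fst β l') ≫ pullback.snd β l' := by
        simpa only [Category.assoc, hβ.lift_snd] using
          hG'.lift_snd _ _ hvw =≫ pullback.snd β l'
      rw [Category.assoc, huu', hvu, hkt]
  have hP := IsPushout.of_hasPushout k r
  subst hkv
  refine ⟨⟨M, _, pushout k r, M', _, pullback.fst _ _, pushout.inl k r, t, pullback.snd _ _,
    pullback.fst _ _, inferInstance, inferInstance, hK⟩,
    ⟨β, pullback.snd β l', e, k, pushout.inr k r, hβ, hkl, by simp [← hn], hkt, hP⟩,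
    n, α', hstrong, G_K, gL, _, hG'.lift _ _ hvw, gR, hP.desc (hG'.lift _ _ hvw ≫ gR) w (by
      simpa using hpo.w), hG', hG'.lift_snd _ _ _, ?_⟩
  refine IsPushout.of_left (s := ?_) (p := ?_) (t := hP)
  · simpa using hpo
  · simp

/-- **PBPO⁺ models PBPO.**
In a (locally small) strongly amendable category with pullbacks and pushouts in
which every morphism factors as an epi followed by a mono, every canonical PBPO
rule `ρ` can be modeled by a set `S` of PBPO⁺ rules: a PBPO step
`G_L ⇒_ρ^{m,α} G_R` exists for some `m`, `α` iff some `σ ∈ S` admits a PBPO⁺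
step `G_L ⇒_σ G_R`. -/
theorem pbpoPlus_models_pbpo
    {C : Type u} [Category.{v} C] [HasPullbacks C] [HasPushouts C]
    -- strong amendability
    (hA : ∀ {L L' : C} (tL : L ⟶ L'),
      ∃ (L'' : C) (tL' : L ⟶ L'') (β : L'' ⟶ L'),
        Mono tL' ∧ tL' ≫ β = tL ∧
        ∀ (G_L : C) (m : L ⟶ G_L) (α : G_L ⟶ L'), Mono m → m ≫ α = tL →
          ∃ α' : G_L ⟶ L'', α' ≫ β = α ∧ m ≫ α' = tL' ∧
            IsPullback (𝟙 L) m tL' α')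
    -- epi-mono factorizations
    (hfact : ∀ {X Y : C} (f : X ⟶ Y),
      ∃ (Z : C) (e : X ⟶ Z) (m : Z ⟶ Y), Epi e ∧ Mono m ∧ e ≫ m = f)
    -- a canonical PBPO rule ρ
    {L K R L' K' R' : C}
    (l : K ⟶ L) (r : K ⟶ R) (tL : L ⟶ L') (tK : K ⟶ K') (tR : R ⟶ R')
    (l' : K' ⟶ L') (r' : K' ⟶ R')
    (hPB : IsPullback l tK tL l') (hPO : IsPushout tK r r' tR) :
    ∃ S : Set (PBPOPlusRule C),
      ∀ (G_L G_R : C),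
        (∃ (m : L ⟶ G_L) (α : G_L ⟶ L'), PBPOStep l r tL tK l' G_R m α) ↔
        (∃ σ ∈ S, PBPOPlusStep σ G_L G_R) := by
  refine ⟨{σ | σ.Refines l r tL tK l'}, fun G_L G_R ↦ ⟨?_, ?_⟩⟩
  · rintro ⟨m, α, hs⟩
    obtain ⟨M, e, n, -, _, hen⟩ := hfact m
    obtain ⟨M', t, β, _, -, ht⟩ := hA (n ≫ α)
    obtain ⟨α', hα, hn, hstrong⟩ := ht G_L n α inferInstance rfl
    exact hs.exists_refines hPB.w hen hα hn hstrong
  · rintro ⟨σ, hσ, hs⟩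
    exact PBPOPlusRule.Refines.exists_pbpoStep hσ hs
end

section
/- For every complete lattice (𝓛, ≤), the category GraphLattice(𝓛,≤) is strongly amendable: for every morphism t_L : L → L' in GraphLattice(𝓛,≤) there exists a factorization t_L = β ∘ t_L' with t_L' : L → L'' a monomorphism and β : L'' → L', such that for every factorization t_L = α ∘ m with m : L → G a monomorphism and α : G → L', there exists α' : G → L'' with β ∘ α' = α, α' ∘ m = t_L', and such that the square with sides 1_L : L → L, m : L → G, t_L' : L → L'', α' : G → L'' is a pullback square. -/
open CategoryTheory CategoryTheory.Limits

universe w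

/-- A graph labeled from a complete lattice `𝓛`: vertices `V`, edges `E`,
source and target maps, and vertex/edge labeling functions into `𝓛`. -/
structure LGraph (𝓛 : Type w) [CompleteLattice 𝓛] where
  V : Type
  E : Type
  src : E → V
  tgt : E → V
  lV : V → 𝓛
  lE : E → 𝓛

/-- A morphism of `𝓛`-labeled graphs: a graph premorphism that may only
increase labels. -/
@[ext]
structure LGraphHom {𝓛 : Type w} [CompleteLattice 𝓛] (G G' : LGraph 𝓛) where
  fV : G.V → G'.V
  fE : G.E → G'.E
  src_comm : ∀ e, G'.src (fE e) = fV (G.src e)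
  tgt_comm : ∀ e, G'.tgt (fE e) = fV (G.tgt e)
  lV_le : ∀ v, G.lV v ≤ G'.lV (fV v)
  lE_le : ∀ e, G.lE e ≤ G'.lE (fE e)

/-- The category `GraphLattice(𝓛,≤)` of `𝓛`-labeled graphs. -/
instance LGraph.category {𝓛 : Type w} [CompleteLattice 𝓛] :
    Category (LGraph 𝓛) where
  Hom := LGraphHom
  id G :=
    { fV := id, fE := id
      src_comm := fun _ => rfl, tgt_comm := fun _ => rfl
      lV_le := fun _ => le_rfl, lE_le := fun _ => le_rfl }
  comp f g :=
    { fV := fun v => g.fV (f.fV v), fE := fun e => g.fE (f.fE e)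
      src_comm := fun e => by rw [g.src_comm, f.src_comm]
      tgt_comm := fun e => by rw [g.tgt_comm, f.tgt_comm]
      lV_le := fun v => (f.lV_le v).trans (g.lV_le _)
      lE_le := fun e => (f.lE_le e).trans (g.lE_le _) }

namespace LGraph

variable {𝓛 : Type w} [CompleteLattice 𝓛]

theorem hom_ext {G H : LGraph 𝓛} {f g : G ⟶ H}
    (hV : ∀ v, LGraphHom.fV f v = LGraphHom.fV g v)
    (hE : ∀ e, LGraphHom.fE f e = LGraphHom.fE g e) : f = g :=
  LGraphHom.ext (funext hV) (funext hE)

theorem mono_of_injective {G H : LGraph 𝓛} (f : G ⟶ H)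
    (hV : Function.Injective (LGraphHom.fV f))
    (hE : Function.Injective (LGraphHom.fE f)) : Mono f where
  right_cancellation _ _ h :=
    hom_ext (fun v => hV (congrFun (congrArg LGraphHom.fV h) v))
      (fun e => hE (congrFun (congrArg LGraphHom.fE h) e))

variable (𝓛) in
/-- The graph with a single vertex, labeled `⊥`, and no edges. -/
def point : LGraph 𝓛 where
  V := Unit
  E := Empty
  src := Empty.elim
  tgt := Empty.elim
  lV _ := ⊥
  lE _ := ⊥

/-- The morphism from the one-vertex graph picking out the vertex `v`. -/
def pointHom {G : LGraph 𝓛} (v : G.V) : point 𝓛 ⟶ G :=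
  LGraphHom.mk (G := point 𝓛) (fun _ => v) (fun e => Empty.elim e) (fun e => Empty.elim e)
    (fun e => Empty.elim e) (fun _ => bot_le) (fun _ => bot_le)

variable (𝓛) in
/-- The graph with a single edge from `false` to `true`, and all labels `⊥`. -/
def arrow : LGraph 𝓛 where
  V := Bool
  E := Unit
  src _ := false
  tgt _ := true
  lV _ := ⊥
  lE _ := ⊥

/-- The morphism from the one-edge graph picking out the edge `e`. -/
def arrowHom {G : LGraph 𝓛} (e : G.E) : arrow 𝓛 ⟶ G :=
  LGraphHom.mk (G := arrow 𝓛) (fun b => bif b then G.tgt e else G.src e) (fun _ => e)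
    (fun _ => rfl) (fun _ => rfl) (fun _ => bot_le) (fun _ => bot_le)

theorem fV_injective {G H : LGraph 𝓛} (f : G ⟶ H) [Mono f] :
    Function.Injective (LGraphHom.fV f) := fun x y h => by
  have key : pointHom x = pointHom y :=
    (cancel_mono f).1 (hom_ext (fun _ => h) (fun e => Empty.elim e))
  exact congrFun (congrArg LGraphHom.fV key) ()

theorem fE_injective {G H : LGraph 𝓛} (f : G ⟶ H) [Mono f] :
    Function.Injective (LGraphHom.fE f) := fun x y h => by
  have key : arrowHom x = arrowHom y := by
    refine (cancel_mono f).1 (hom_ext (fun b => ?_) (fun _ => h))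
    cases b
    · exact (LGraphHom.src_comm f x).symm.trans
        ((congrArg H.src h).trans (LGraphHom.src_comm f y))
    · exact (LGraphHom.tgt_comm f x).symm.trans
        ((congrArg H.tgt h).trans (LGraphHom.tgt_comm f y))
  exact congrFun (congrArg LGraphHom.fE key) ()

/-- A commutative triangle `m ≫ g = f` is a pullback square along the identity as soon as
the only preimages under `g` of points in the image of `f` are the evident ones. -/
theorem isPullback_id_of_eq {L G H : LGraph 𝓛} {m : L ⟶ G} {f : L ⟶ H} {g : G ⟶ H}
    (w : m ≫ g = f)
    (hV : ∀ x y, LGraphHom.fV f x = LGraphHom.fV g y → LGraphHom.fV m x = y)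
    (hE : ∀ x y, LGraphHom.fE f x = LGraphHom.fE g y → LGraphHom.fE m x = y) :
    IsPullback (𝟙 L) m f g :=
  ⟨⟨by rw [Category.id_comp, w]⟩,
    ⟨PullbackCone.IsLimit.mk _ (fun s => s.fst) (fun s => Category.comp_id _)
      (fun s => hom_ext
        (fun v => hV _ _ (congrFun (congrArg LGraphHom.fV s.condition) v))
        (fun e => hE _ _ (congrFun (congrArg LGraphHom.fE s.condition) e)))
      (fun s l h _ => by rw [← h, Category.comp_id])⟩⟩

section Amendment

variable {L L' : LGraph 𝓛} (t : L ⟶ L')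

/-- The projection on vertices of the amendment of `t`. -/
def amendV : L.V ⊕ L'.V → L'.V := Sum.elim (LGraphHom.fV t) id

/-- The edges of the amendment of `t`. -/
abbrev AmendE : Type :=
  L.E ⊕ {p : (L.V ⊕ L'.V) × (L.V ⊕ L'.V) × L'.E //
    L'.src p.2.2 = amendV t p.1 ∧ L'.tgt p.2.2 = amendV t p.2.1}

/-- The projection on edges of the amendment of `t`. -/
def amendE : AmendE t → L'.E := Sum.elim (LGraphHom.fE t) (fun p => p.1.2.2)

/-- The graph obtained from `L` by adjoining a copy of the vertices of `L'` and, over every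
edge of `L'`, a new edge between any two vertices lying over its endpoints. All labels are
those of `L'`. -/
def amend : LGraph 𝓛 where
  V := L.V ⊕ L'.V
  E := AmendE t
  src := Sum.elim (fun e => .inl (L.src e)) (fun p => p.1.1)
  tgt := Sum.elim (fun e => .inl (L.tgt e)) (fun p => p.1.2.1)
  lV v := L'.lV (amendV t v)
  lE e := L'.lE (amendE t e)

/-- The inclusion of `L` into the amendment of `t`. -/
def amendInl : L ⟶ amend t :=
  LGraphHom.mk (G' := amend t) Sum.inl Sum.inl (fun _ => rfl) (fun _ => rfl)
    (LGraphHom.lV_le t) (LGraphHom.lE_le t)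

/-- The projection of the amendment of `t` onto `L'`. -/
def amendProj : amend t ⟶ L' :=
  LGraphHom.mk (G := amend t) (amendV t) (amendE t)
    (by
      rintro (e | p)
      · exact LGraphHom.src_comm t e
      · exact p.2.1)
    (by
      rintro (e | p)
      · exact LGraphHom.tgt_comm t e
      · exact p.2.2)
    (fun _ => le_rfl) (fun _ => le_rfl)

instance : Mono (amendInl t) :=
  mono_of_injective _ Sum.inl_injective Sum.inl_injective

variable {t} {G : LGraph 𝓛} (m : L ⟶ G) (α : G ⟶ L')

open Classical in
/-- The vertex map of the classifying morphism into the amendment. -/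
noncomputable def amendLiftV (v : G.V) : L.V ⊕ L'.V :=
  if h : ∃ x, LGraphHom.fV m x = v then .inl h.choose else .inr (LGraphHom.fV α v)

theorem amendLiftV_fV [Mono m] (x : L.V) :
    amendLiftV m α (LGraphHom.fV m x) = .inl x := by
  have h : ∃ y, LGraphHom.fV m y = LGraphHom.fV m x := ⟨x, rfl⟩
  rw [amendLiftV, dif_pos h, fV_injective m h.choose_spec]

theorem fV_eq_of_amendLiftV {x : L.V} {v : G.V} (hx : .inl x = amendLiftV m α v) :
    LGraphHom.fV m x = v := by
  by_cases h : ∃ y, LGraphHom.fV m y = v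
  · rw [amendLiftV, dif_pos h] at hx
    rw [Sum.inl_injective hx, h.choose_spec]
  · rw [amendLiftV, dif_neg h] at hx
    cases hx

theorem amendV_amendLiftV (w : m ≫ α = t) (v : G.V) :
    amendV t (amendLiftV m α v) = LGraphHom.fV α v := by
  subst w
  by_cases h : ∃ y, LGraphHom.fV m y = v
  · rw [amendLiftV, dif_pos h]
    exact congrArg (LGraphHom.fV α) h.choose_spec
  · rw [amendLiftV, dif_neg h]
    rfl

open Classical in
/-- The edge map of the classifying morphism into the amendment. -/
noncomputable def amendLiftE (w : m ≫ α = t) (e : G.E) : AmendE t :=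
  if h : ∃ x, LGraphHom.fE m x = e then .inl h.choose
  else .inr ⟨(amendLiftV m α (G.src e), amendLiftV m α (G.tgt e), LGraphHom.fE α e),
    (LGraphHom.src_comm α e).trans (amendV_amendLiftV m α w _).symm,
    (LGraphHom.tgt_comm α e).trans (amendV_amendLiftV m α w _).symm⟩

theorem amendLiftE_fE [Mono m] (w : m ≫ α = t) (x : L.E) :
    amendLiftE m α w (LGraphHom.fE m x) = .inl x := by
  have h : ∃ y, LGraphHom.fE m y = LGraphHom.fE m x := ⟨x, rfl⟩
  rw [amendLiftE, dif_pos h, fE_injective m h.choose_spec]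

theorem fE_eq_of_amendLiftE (w : m ≫ α = t) {x : L.E} {e : G.E}
    (hx : .inl x = amendLiftE m α w e) : LGraphHom.fE m x = e := by
  by_cases h : ∃ y, LGraphHom.fE m y = e
  · rw [amendLiftE, dif_pos h] at hx
    rw [Sum.inl_injective hx, h.choose_spec]
  · rw [amendLiftE, dif_neg h] at hx
    cases hx

theorem amendE_amendLiftE (w : m ≫ α = t) (e : G.E) :
    amendE t (amendLiftE m α w e) = LGraphHom.fE α e := by
  subst w
  by_cases h : ∃ y, LGraphHom.fE m y = e
  · rw [amendLiftE, dif_pos h]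
    exact congrArg (LGraphHom.fE α) h.choose_spec
  · rw [amendLiftE, dif_neg h]
    rfl

/-- The classifying morphism of a factorization `t = m ≫ α` through a monomorphism `m`. -/
noncomputable def amendLift [Mono m] (w : m ≫ α = t) : G ⟶ amend t :=
  LGraphHom.mk (G' := amend t) (amendLiftV m α) (amendLiftE m α w)
    (fun e => by
      by_cases h : ∃ y, LGraphHom.fE m y = e
      · obtain ⟨y, rfl⟩ := h
        rw [amendLiftE_fE, LGraphHom.src_comm m y, amendLiftV_fV]
        rfl
      · exact congrArg (amend t).src (dif_neg h))
    (fun e => by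
      by_cases h : ∃ y, LGraphHom.fE m y = e
      · obtain ⟨y, rfl⟩ := h
        rw [amendLiftE_fE, LGraphHom.tgt_comm m y, amendLiftV_fV]
        rfl
      · exact congrArg (amend t).tgt (dif_neg h))
    (fun v => (LGraphHom.lV_le α v).trans_eq
      (congrArg L'.lV (amendV_amendLiftV m α w v).symm))
    (fun e => (LGraphHom.lE_le α e).trans_eq
      (congrArg L'.lE (amendE_amendLiftE m α w e).symm))

theorem comp_amendLift [Mono m] (w : m ≫ α = t) : m ≫ amendLift m α w = amendInl t :=
  hom_ext (amendLiftV_fV m α) (amendLiftE_fE m α w)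

theorem amendLift_comp_amendProj [Mono m] (w : m ≫ α = t) :
    amendLift m α w ≫ amendProj t = α :=
  hom_ext (amendV_amendLiftV m α w) (amendE_amendLiftE m α w)

end Amendment

end LGraph

/-- **`GraphLattice(𝓛,≤)` is strongly amendable** for every complete lattice
`𝓛`: every morphism `t_L : L ⟶ L'` factors as a mono `t_L' : L ⟶ L''`
followed by `β : L'' ⟶ L'`, such that every factorization `t_L = m ≫ α` with
`m` monic admits `α'` with `α' ≫ β = α`, `m ≫ α' = t_L'`, and the square
`𝟙 L ≫ t_L' = m ≫ α'` a pullback. -/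
theorem lGraph_stronglyAmendable (𝓛 : Type w) [CompleteLattice 𝓛]
    {L L' : LGraph 𝓛} (tL : L ⟶ L') :
    ∃ (L'' : LGraph 𝓛) (tL' : L ⟶ L'') (β : L'' ⟶ L'),
      Mono tL' ∧ tL' ≫ β = tL ∧
      ∀ (G : LGraph 𝓛) (m : L ⟶ G) (α : G ⟶ L'), Mono m → m ≫ α = tL →
        ∃ α' : G ⟶ L'', α' ≫ β = α ∧ m ≫ α' = tL' ∧
          IsPullback (𝟙 L) m tL' α' := by
  refine ⟨LGraph.amend tL, LGraph.amendInl tL, LGraph.amendProj tL, inferInstance, rfl, ?_⟩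
  intro G m α _ w
  exact ⟨LGraph.amendLift m α w, LGraph.amendLift_comp_amendProj m α w,
    LGraph.comp_amendLift m α w,
    LGraph.isPullback_id_of_eq (LGraph.comp_amendLift m α w)
      (fun _ _ => LGraph.fV_eq_of_amendLiftV m α)
      (fun _ _ => LGraph.fE_eq_of_amendLiftE m α w)⟩
end

section
/- For every complete lattice (𝓛, ≤), the category GraphLattice(𝓛,≤) has all pullbacks. Concretely, the pullback of a cospan φ : A → C, ψ : B → C is computed as in the category of unlabeled graphs on underlying vertex and edge sets (vertices {(a,b) ∈ V_A × V_B : φ_V(a) = ψ_V(b)} and similarly for edges, with componentwise source and target), where each element (a,b) of the pullback carries the label ℓ_A(a) ∧ ℓ_B(b), the meet of the labels of its two components. -/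
open CategoryTheory CategoryTheory.Limits

universe w

variable {𝓛 : Type w} [CompleteLattice 𝓛]

/-- The concrete pullback graph of a cospan `φ : A ⟶ C`, `ψ : B ⟶ C` in
`GraphLattice(𝓛,≤)`: the usual pullback of unlabeled graphs (pairs of vertices
resp. edges agreeing in `C`, with componentwise source and target), where each
pair carries the meet of the labels of its two components. -/
def LGraph.pbGraph {A B C : LGraph 𝓛} (φ : A ⟶ C) (ψ : B ⟶ C) : LGraph 𝓛 where
  V := { p : A.V × B.V // φ.fV p.1 = ψ.fV p.2 }
  E := { p : A.E × B.E // φ.fE p.1 = ψ.fE p.2 }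
  src e := ⟨(A.src e.1.1, B.src e.1.2), by
    rw [← φ.src_comm, ← ψ.src_comm, e.2]⟩
  tgt e := ⟨(A.tgt e.1.1, B.tgt e.1.2), by
    rw [← φ.tgt_comm, ← ψ.tgt_comm, e.2]⟩
  lV p := A.lV p.1.1 ⊓ B.lV p.1.2
  lE e := A.lE e.1.1 ⊓ B.lE e.1.2

/-- First projection of the concrete pullback graph. -/
def LGraph.pbFst {A B C : LGraph 𝓛} (φ : A ⟶ C) (ψ : B ⟶ C) :
    LGraph.pbGraph φ ψ ⟶ A where
  fV p := p.1.1
  fE e := e.1.1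
  src_comm _ := rfl
  tgt_comm _ := rfl
  lV_le _ := inf_le_left
  lE_le _ := inf_le_left

/-- Second projection of the concrete pullback graph. -/
def LGraph.pbSnd {A B C : LGraph 𝓛} (φ : A ⟶ C) (ψ : B ⟶ C) :
    LGraph.pbGraph φ ψ ⟶ B where
  fV p := p.1.2
  fE e := e.1.2
  src_comm _ := rfl
  tgt_comm _ := rfl
  lV_le _ := inf_le_right
  lE_le _ := inf_le_right

@[ext]
theorem LGraph.hom_ext_s13 {G G' : LGraph 𝓛} {f g : G ⟶ G'}
    (hV : ∀ v, f.fV v = g.fV v) (hE : ∀ e, f.fE e = g.fE e) : f = g :=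
  LGraphHom.ext (funext hV) (funext hE)

/-- The morphism into the concrete pullback graph induced by a commutative square. -/
def LGraph.pbLift {A B C X : LGraph 𝓛} (φ : A ⟶ C) (ψ : B ⟶ C) (f : X ⟶ A) (g : X ⟶ B)
    (w : f ≫ φ = g ≫ ψ) : X ⟶ LGraph.pbGraph φ ψ where
  fV v := ⟨(f.fV v, g.fV v), congrFun (congrArg LGraphHom.fV w) v⟩
  fE e := ⟨(f.fE e, g.fE e), congrFun (congrArg LGraphHom.fE w) e⟩
  src_comm e := Subtype.ext (Prod.ext (f.src_comm e) (g.src_comm e))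
  tgt_comm e := Subtype.ext (Prod.ext (f.tgt_comm e) (g.tgt_comm e))
  lV_le v := le_inf (f.lV_le v) (g.lV_le v)
  lE_le e := le_inf (f.lE_le e) (g.lE_le e)

theorem LGraph.isPullback_pbGraph {A B C : LGraph 𝓛} (φ : A ⟶ C) (ψ : B ⟶ C) :
    IsPullback (LGraph.pbFst φ ψ) (LGraph.pbSnd φ ψ) φ ψ where
  w := LGraph.hom_ext_s13 (fun v => v.2) (fun e => e.2)
  isLimit' := ⟨PullbackCone.IsLimit.mk _
    (fun s => LGraph.pbLift φ ψ s.fst s.snd s.condition)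
    (fun _ => rfl) (fun _ => rfl)
    (fun _ _ h₁ h₂ => LGraph.hom_ext_s13
      (fun v => Subtype.ext (Prod.ext (congrFun (congrArg LGraphHom.fV h₁) v)
        (congrFun (congrArg LGraphHom.fV h₂) v)))
      (fun e => Subtype.ext (Prod.ext (congrFun (congrArg LGraphHom.fE h₁) e)
        (congrFun (congrArg LGraphHom.fE h₂) e))))⟩

/-- **`GraphLattice(𝓛,≤)` has all pullbacks**, and the pullback of a cospan
`φ : A ⟶ C`, `ψ : B ⟶ C` is computed as for unlabeled graphs, with each
element of the pullback labeled by the meet of the labels of its two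
components. -/
theorem lGraph_hasPullbacks (𝓛 : Type w) [CompleteLattice 𝓛] :
    HasPullbacks (LGraph 𝓛) ∧
    ∀ {A B C : LGraph 𝓛} (φ : A ⟶ C) (ψ : B ⟶ C),
      IsPullback (LGraph.pbFst φ ψ) (LGraph.pbSnd φ ψ) φ ψ := by
  have isPullback {A B C : LGraph 𝓛} (φ : A ⟶ C) (ψ : B ⟶ C) :=
    LGraph.isPullback_pbGraph φ ψ
  have {A B C : LGraph 𝓛} {φ : A ⟶ C} {ψ : B ⟶ C} : HasLimit (cospan φ ψ) :=
    (isPullback φ ψ).hasPullback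
  exact ⟨hasPullbacks_of_hasLimit_cospan _, isPullback⟩
end

section
/- Let (𝓛, ≤) be a complete lattice whose minimum ⊥ and maximum ⊤ are distinct. In the category GraphLattice(𝓛,≤), pushout complements along monomorphisms are not unique up to isomorphism: writing [x] for the one-vertex edgeless graph whose vertex is labeled x ∈ 𝓛, for each X ∈ {⊥, ⊤} the square with top morphism [⊥] → [⊤], left morphism [⊥] → [X], bottom morphism [X] → [⊤] and right morphism the identity on [⊤] (all given by the unique vertex map) is a pushout square, and all four morphisms in it are monomorphisms, yet the two complements [⊥] → [⊥] → [⊤] and [⊥] → [⊤] → [⊤] are not isomorphic. Consequently GraphLattice(𝓛,≤) is not adhesive. -/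
open CategoryTheory CategoryTheory.Limits

universe w

variable {𝓛 : Type w} [CompleteLattice 𝓛]

/-- The one-vertex edgeless graph whose vertex is labeled `x`. -/
def LGraph.pt (x : 𝓛) : LGraph 𝓛 where
  V := PUnit
  E := PEmpty
  src e := e.elim
  tgt e := e.elim
  lV _ := x
  lE e := e.elim

/-- The unique (vertex-map) morphism `[x] ⟶ [y]`, for `x ≤ y`. -/
def LGraph.ptHom {x y : 𝓛} (h : x ≤ y) : LGraph.pt x ⟶ LGraph.pt y where
  fV _ := PUnit.unit
  fE e := e.elim
  src_comm e := e.elim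
  tgt_comm e := e.elim
  lV_le _ := h
  lE_le e := e.elim

namespace LGraph

/-- A morphism out of a one-vertex edgeless graph is determined by the image of the vertex. -/
theorem pt_hom_ext {x : 𝓛} {G : LGraph 𝓛} {f g : pt x ⟶ G}
    (h : f.fV PUnit.unit = g.fV PUnit.unit) : f = g :=
  LGraphHom.ext (funext fun _ => h) (funext fun e => e.elim)

/-- There is a morphism `[x] ⟶ [y]` only if `x ≤ y`. -/
theorem le_of_pt_hom {x y : 𝓛} (f : pt x ⟶ pt y) : x ≤ y :=
  f.lV_le PUnit.unit

theorem mono_ptHom {x y : 𝓛} (h : x ≤ y) : Mono (ptHom h) where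
  right_cancellation {_} _ _ _ :=
    LGraphHom.ext (funext fun _ => rfl) (funext fun _ => Subsingleton.elim (α := PEmpty) _ _)

theorem isPushout_ptHom {x y z : 𝓛} (hxy : x ≤ y) (hxz : x ≤ z) (hzy : z ≤ y) :
    IsPushout (ptHom hxy) (ptHom hxz) (𝟙 (pt y)) (ptHom hzy) where
  w := pt_hom_ext rfl
  isColimit' := ⟨PushoutCocone.IsColimit.mk _ (fun s => s.inl)
    (fun _ => Category.id_comp _)
    (fun s => pt_hom_ext (congrArg (fun k : pt x ⟶ s.pt => k.fV PUnit.unit) s.condition))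
    (fun _ _ h _ => (Category.id_comp _).symm.trans h)⟩

/-- In an adhesive category the pushout of `[x] ⟶ [y]` along itself is a pullback, whose
universal property gives a morphism `[y] ⟶ [x]`. -/
theorem le_of_adhesive [Adhesive (LGraph 𝓛)] {x y : 𝓛} (h : x ≤ y) : y ≤ x :=
  have := mono_ptHom h
  le_of_pt_hom ((Adhesive.isPullback_of_isPushout_of_mono_left
    (isPushout_ptHom h h le_rfl)).lift (𝟙 _) (𝟙 _) (pt_hom_ext rfl))

end LGraph

/-- **Pushout complements along monos are not unique in `GraphLattice(𝓛,≤)`**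
when `⊥ ≠ ⊤`: for each `X ∈ {⊥, ⊤}` the square with top `[⊥] ⟶ [⊤]`, left
`[⊥] ⟶ [X]`, right the identity of `[⊤]` and bottom `[X] ⟶ [⊤]` is a pushout
square whose four morphisms are all monomorphisms, yet the two complements
`[⊥] ⟶ [⊥] ⟶ [⊤]` and `[⊥] ⟶ [⊤] ⟶ [⊤]` are not isomorphic (already the
middle objects `[⊥]` and `[⊤]` are non-isomorphic). Consequently
`GraphLattice(𝓛,≤)` is not adhesive. -/
theorem lGraph_pushout_complement_not_unique
    (𝓛 : Type w) [CompleteLattice 𝓛] (hne : (⊥ : 𝓛) ≠ ⊤) :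
    (∀ X : 𝓛, X = ⊥ ∨ X = ⊤ →
      IsPushout (LGraph.ptHom (le_top : (⊥ : 𝓛) ≤ ⊤))
        (LGraph.ptHom (bot_le : (⊥ : 𝓛) ≤ X))
        (𝟙 (LGraph.pt (⊤ : 𝓛)))
        (LGraph.ptHom (le_top : X ≤ ⊤)) ∧
      Mono (LGraph.ptHom (le_top : (⊥ : 𝓛) ≤ ⊤)) ∧
      Mono (LGraph.ptHom (bot_le : (⊥ : 𝓛) ≤ X)) ∧
      Mono (𝟙 (LGraph.pt (⊤ : 𝓛))) ∧
      Mono (LGraph.ptHom (le_top : X ≤ ⊤))) ∧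
    ¬ Nonempty (LGraph.pt (⊥ : 𝓛) ≅ LGraph.pt (⊤ : 𝓛)) ∧
    ¬ Adhesive (LGraph 𝓛) := by
  exact ⟨fun _ _ => ⟨LGraph.isPushout_ptHom _ _ _, LGraph.mono_ptHom _, LGraph.mono_ptHom _,
      inferInstance, LGraph.mono_ptHom _⟩,
    fun ⟨e⟩ => hne (le_antisymm bot_le (LGraph.le_of_pt_hom e.inv)),
    fun _ => hne (le_antisymm bot_le (LGraph.le_of_adhesive bot_le))⟩
end

section
/- Let C be a category. Let σ = (L, K, R, L', K', l, r, t_L, t_K, l') be a PBPO⁺ rule, extended to a canonical PBPO rule by taking a pushout (r' : K' → R', t_R : R → R') of the span t_K : K → K', r : K → R. Then every PBPO⁺ step is a PBPO step: if G_L ⇒_σ^{α} G_R is a PBPO⁺ step with strong match (m, α), then G_L ⇒_σ^{m,α} G_R is a PBPO step of the extended canonical rule. In particular the PBPO⁺ rewrite relation of σ is contained in the PBPO rewrite relation of the extended rule. -/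
open CategoryTheory CategoryTheory.Limits

universe v u

/-- A PBPO⁺ rewrite step `G_L ⇒_σ^α G_R` with match `m` and adherence `α`:
`(m, α)` is a strong match for `tL`, `(gL, u')` is a pullback of `(α, l')`,
`u : K ⟶ G_K` is the (unique) morphism with `u ≫ u' = tK`, and `(gR, w)` is a
pushout of `(u, r)`. -/
def PBPOPlusStepWith {C : Type u} [Category.{v} C]
    {L K R L' K' : C}
    (l : K ⟶ L) (r : K ⟶ R) (tL : L ⟶ L') (tK : K ⟶ K') (l' : K' ⟶ L')
    {G_L : C} (G_R : C) (m : L ⟶ G_L) (α : G_L ⟶ L') : Prop :=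
  IsPullback (𝟙 L) m tL α ∧
  ∃ (G_K : C) (gL : G_K ⟶ G_L) (u' : G_K ⟶ K') (u : K ⟶ G_K)
    (gR : G_K ⟶ G_R) (w : R ⟶ G_R),
    IsPullback gL u' α l' ∧ u ≫ u' = tK ∧ IsPushout u r gR w

/-- **Every PBPO⁺ step is a PBPO step.**
Let `σ` be a PBPO⁺ rule (`tL`, `tK` monic and `l ≫ tL = tK ≫ l'` a pullback),
extended to a canonical PBPO rule by a pushout `(r', tR)` of the span
`(tK, r)`. If `G_L ⇒_σ^α G_R` is a PBPO⁺ step with strong match `(m, α)`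
then `G_L ⇒_σ^{m,α} G_R` is a PBPO step of the extended rule; in particular
the PBPO⁺ rewrite relation of `σ` is contained in the PBPO rewrite relation
of the extended rule. -/
theorem pbpoPlus_step_is_pbpo_step
    {C : Type u} [Category.{v} C]
    {L K R L' K' R' : C}
    (l : K ⟶ L) (r : K ⟶ R) (tL : L ⟶ L') (tK : K ⟶ K') (l' : K' ⟶ L')
    [Mono tL] [Mono tK]
    (hrule : IsPullback l tK tL l')
    (r' : K' ⟶ R') (tR : R ⟶ R') (hext : IsPushout tK r r' tR) :
    (∀ {G_L : C} (G_R : C) (m : L ⟶ G_L) (α : G_L ⟶ L'),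
      PBPOPlusStepWith l r tL tK l' G_R m α →
      PBPOStep l r tL tK l' G_R m α) ∧
    (∀ (G_L G_R : C),
      (∃ (m : L ⟶ G_L) (α : G_L ⟶ L'), PBPOPlusStepWith l r tL tK l' G_R m α) →
      (∃ (m : L ⟶ G_L) (α : G_L ⟶ L'), PBPOStep l r tL tK l' G_R m α)) := by
  have step : ∀ {G_L : C} (G_R : C) (m : L ⟶ G_L) (α : G_L ⟶ L'),
      PBPOPlusStepWith l r tL tK l' G_R m α → PBPOStep l r tL tK l' G_R m α := by
    rintro G_L G_R m α ⟨hm, G_K, gL, u', u, gR, w, hpb, hu, hpo⟩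
    refine ⟨by simpa using hm.w, G_K, gL, u', u, gR, w, hpb, ?_, hu, hpo⟩
    have h : l ≫ tL = (u ≫ gL) ≫ α := by
      rw [Category.assoc, hpb.w, ← Category.assoc, hu, hrule.w]
    have h_fst : hm.lift l (u ≫ gL) h = l := by
      simpa using hm.lift_fst l (u ≫ gL) h
    rw [← hm.lift_snd l (u ≫ gL) h, h_fst]
  exact ⟨step, fun G_L G_R ⟨m, α, h⟩ => ⟨m, α, step G_R m α h⟩⟩
end
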